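/- The polyiamond T₄,₁ = {(0,0,0),(0,0,1),(1,0,0),(1,0,1)} (a strip of four triangles) has threshold sequence (0,3,8,∞): it is a (1,0)-winner, a (1,1)-loser, a (2,3)-winner, a (2,4)-loser, a (3,8)-winner, a (3,9)-loser, and an (n,b)-winner for every n ≥ 4 and every b ∈ ℕ. -/

import Mathlib

/-- Cells of the triangular board: `(x, y, u)` with `u = 0` an upward triangle
and `u = 1` a downward triangle. -/
abbrev TriCell : Type := ℤ × ℤ × Fin 2

/-- The downward cell `(x,y,1)` is adjacent exactly to the upward cells
`(x,y,0)`, `(x+1,y,0)` and `(x,y+1,0)`. -/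
def TriAdjacent (p q : TriCell) : Prop :=
  ∃ x y : ℤ,
    (p = (x, y, 1) ∧ (q = (x, y, 0) ∨ q = (x + 1, y, 0) ∨ q = (x, y + 1, 0))) ∨
    (q = (x, y, 1) ∧ (p = (x, y, 0) ∨ p = (x + 1, y, 0) ∨ p = (x, y + 1, 0)))

/-- A polyiamond is a finite nonempty set of cells that is connected under adjacency. -/
def IsPolyiamond (A : Finset TriCell) : Prop :=
  A.Nonempty ∧ ∀ p ∈ A, ∀ q ∈ A,
    Relation.ReflTransGen (fun u v => u ∈ A ∧ v ∈ A ∧ TriAdjacent u v) p q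

/-- Rotation of the triangular tiling by 60 degrees about a vertex,
expressed in these coordinates. -/
def triRot : Function.End TriCell := fun p =>
  if p.2.2 = 0 then (-p.2.1 - 1, p.1 + p.2.1, 1) else (-p.2.1 - 1, p.1 + p.2.1 + 1, 0)

/-- A reflection of the triangular tiling, expressed in these coordinates. -/
def triRefl : Function.End TriCell := fun p => (p.2.1, p.1, p.2.2)

/-- Translations of the triangular tiling. -/
def IsTriTranslation (f : Function.End TriCell) : Prop :=
  ∃ a b : ℤ, f = fun p => (p.1 + a, p.2.1 + b, p.2.2)

/-- The symmetries of the triangular tiling: all compositions of translations,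
rotations by multiples of 60 degrees and reflections.  (Since `triRot` has order 6,
`triRefl` has order 2, and the set of translations is closed under inverses, the
monoid generated by them is the full symmetry group.) -/
def triSymmetries : Submonoid (Function.End TriCell) :=
  Submonoid.closure ({f | IsTriTranslation f} ∪ {triRot, triRefl})

/-- `P` is a placement of the polyiamond `A`: the image of `A` under a symmetry
of the triangular tiling. -/
def IsTriPlacement (A : Finset TriCell) (P : Set TriCell) : Prop :=
  ∃ f ∈ triSymmetries, P = (f : TriCell → TriCell) '' (↑A : Set TriCell)

/-- The maker's move on his `n`-th turn (`0`-indexed), given his strategy `σ`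
(a function of the list of the breaker's previous moves, which together with `σ`
determines the whole history) and the breaker's sequence of moves `β`. -/
def makerMove (σ : List (Finset TriCell) → Finset TriCell) (β : ℕ → Finset TriCell)
    (n : ℕ) : Finset TriCell :=
  σ ((List.range n).map β)

/-- The set of cells marked by the maker after his first `n` turns. -/
def makerMarks (σ : List (Finset TriCell) → Finset TriCell) (β : ℕ → Finset TriCell) :
    ℕ → Finset TriCell
  | 0 => ∅
  | n + 1 => makerMarks σ β n ∪ makerMove σ β n

/-- The set of cells marked by the breaker after her first `n` turns. -/
def breakerMarks (β : ℕ → Finset TriCell) : ℕ → Finset TriCell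
  | 0 => ∅
  | n + 1 => breakerMarks β n ∪ β n

/-- The maker plays legally: on every turn he marks exactly `a` previously unmarked cells. -/
def MakerLegal (a : ℕ) (σ : List (Finset TriCell) → Finset TriCell)
    (β : ℕ → Finset TriCell) : Prop :=
  ∀ n, (makerMove σ β n).card = a ∧
    Disjoint (makerMove σ β n) (makerMarks σ β n ∪ breakerMarks β n)

/-- The breaker plays legally: on every turn she marks exactly `b` previously unmarked
cells (on turn `n` she moves after the maker, so she must avoid `makerMarks σ β (n+1)`). -/
def BreakerLegal (b : ℕ) (σ : List (Finset TriCell) → Finset TriCell)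
    (β : ℕ → Finset TriCell) : Prop :=
  ∀ n, (β n).card = b ∧ Disjoint (β n) (makerMarks σ β (n + 1) ∪ breakerMarks β n)

/-- `A` is an `(a,b)`-winner: the maker has a winning strategy in the weak `(a,b)`
achievement game with goal `A`, i.e. a strategy that always plays legally against any
legal breaker play and eventually marks all cells of some placement of `A`. -/
def IsWinner (A : Finset TriCell) (a b : ℕ) : Prop :=
  ∃ σ : List (Finset TriCell) → Finset TriCell, ∀ β : ℕ → Finset TriCell,
    BreakerLegal b σ β →
      MakerLegal a σ β ∧
        ∃ n, ∃ P : Set TriCell, IsTriPlacement A P ∧ P ⊆ ↑(makerMarks σ β n)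

/-- The polyiamond `T₄,₁`, a strip of four triangles. -/
def T41 : Finset TriCell := {(0, 0, 0), (0, 0, 1), (1, 0, 0), (1, 0, 1)}


section T41Aux

open Finset

/-- Six explicit forms of a strip of four cells. -/
def StripForm (p0 p1 p2 p3 : TriCell) : Prop :=
  ∃ x y a c b d : ℤ,
    ((a = 0 ∧ c = 0) ∨ (a = 1 ∧ c = 0) ∨ (a = 0 ∧ c = 1)) ∧
    ((b = 0 ∧ d = 0) ∨ (b = 1 ∧ d = 0) ∨ (b = 0 ∧ d = 1)) ∧
    (a ≠ b ∨ c ≠ d) ∧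
    p0 = (x + a, y + c, 0) ∧ p1 = (x, y, 1) ∧ p2 = (x + b, y + d, 0) ∧
    p3 = (x + b - a, y + d - c, 1)

def StripGood (p0 p1 p2 p3 : TriCell) : Prop :=
  StripForm p0 p1 p2 p3 ∨ StripForm p3 p2 p1 p0

lemma stripForm_trans (s t : ℤ) {p0 p1 p2 p3 : TriCell} (h : StripForm p0 p1 p2 p3) :
    StripForm (p0.1 + s, p0.2.1 + t, p0.2.2) (p1.1 + s, p1.2.1 + t, p1.2.2)
      (p2.1 + s, p2.2.1 + t, p2.2.2) (p3.1 + s, p3.2.1 + t, p3.2.2) := by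
  obtain ⟨x, y, a, c, b, d, ha, hb, hab, rfl, rfl, rfl, rfl⟩ := h
  refine ⟨x + s, y + t, a, c, b, d, ha, hb, hab, ?_, ?_, ?_, ?_⟩ <;>
    simp only [Prod.mk.injEq, and_true] <;> omega

lemma stripForm_refl {p0 p1 p2 p3 : TriCell} (h : StripForm p0 p1 p2 p3) :
    StripForm (triRefl p0) (triRefl p1) (triRefl p2) (triRefl p3) := by
  obtain ⟨x, y, a, c, b, d, ha, hb, hab, rfl, rfl, rfl, rfl⟩ := h
  refine ⟨y, x, c, a, d, b, by omega, by omega, by omega, ?_, ?_, ?_, ?_⟩ <;>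
    simp [triRefl]

lemma stripForm_rot {p0 p1 p2 p3 : TriCell} (h : StripForm p0 p1 p2 p3) :
    StripForm (triRot p3) (triRot p2) (triRot p1) (triRot p0) := by
  obtain ⟨x, y, a, c, b, d, ha, hb, hab, rfl, rfl, rfl, rfl⟩ := h
  refine ⟨-(y + d) - 1, x + b + (y + d), c, 1 - a - c, d, 1 - b - d,
    by omega, by omega, by omega, ?_, ?_, ?_, ?_⟩ <;>
    simp [triRot] <;> omega

lemma stripGood_symm {f : Function.End TriCell} (hf : f ∈ triSymmetries) :
    ∀ p0 p1 p2 p3 : TriCell, StripGood p0 p1 p2 p3 → StripGood (f p0) (f p1) (f p2) (f p3) := by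
  unfold triSymmetries at hf
  induction hf using Submonoid.closure_induction with
  | mem g hg =>
    intro p0 p1 p2 p3 h
    rcases hg with ⟨s, t, rfl⟩ | hg
    · exact h.imp (stripForm_trans s t) (stripForm_trans s t)
    · rcases hg with rfl | hg
      · exact h.symm.imp stripForm_rot stripForm_rot
      · rw [Set.mem_singleton_iff] at hg
        subst hg
        exact h.imp stripForm_refl stripForm_refl
  | one => intro p0 p1 p2 p3 h; exact h
  | mul g k _ _ hg hk =>
    intro p0 p1 p2 p3 h
    exact hg _ _ _ _ (hk _ _ _ _ h)

lemma placement_strip {P : Set TriCell} (h : IsTriPlacement T41 P) :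
    ∃ p0 p1 p2 p3, StripForm p0 p1 p2 p3 ∧ p0 ∈ P ∧ p1 ∈ P ∧ p2 ∈ P ∧ p3 ∈ P := by
  obtain ⟨f, hf, rfl⟩ := h
  have h0 : StripGood (0, 0, 0) (0, 0, 1) (1, 0, 0) (1, 0, 1) :=
    Or.inl ⟨0, 0, 0, 0, 1, 0, by simp, by simp, by simp, by simp, by simp, by simp, by simp⟩
  have hm : ∀ c ∈ T41, f c ∈ (f : TriCell → TriCell) '' (↑T41 : Set TriCell) :=
    fun c hc => Set.mem_image_of_mem _ hc
  have m0 := hm (0, 0, 0) (by simp [T41])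
  have m1 := hm (0, 0, 1) (by simp [T41])
  have m2 := hm (1, 0, 0) (by simp [T41])
  have m3 := hm (1, 0, 1) (by simp [T41])
  rcases stripGood_symm hf _ _ _ _ h0 with h | h
  · exact ⟨_, _, _, _, h, m0, m1, m2, m3⟩
  · exact ⟨_, _, _, _, h, m3, m2, m1, m0⟩

/-! ### Extending to a given size -/

lemma exists_ext (Q X : Finset TriCell) (a : ℕ) (hQ : Q.card ≤ a) (hd : Disjoint Q X) :
    ∃ S : Finset TriCell, Q ⊆ S ∧ S.card = a ∧ Disjoint S X := by
  obtain ⟨t, ht, hc⟩ := Infinite.exists_superset_card_eq (Q ∪ X) (a + X.card)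
    (by rw [card_union_of_disjoint hd]; omega)
  have hX : X ⊆ t := subset_union_right.trans ht
  refine ⟨t \ X, ?_, ?_, sdiff_disjoint⟩
  · intro q hq
    rw [mem_sdiff]
    exact ⟨ht (mem_union_left _ hq), fun h => (disjoint_left.1 hd hq) h⟩
  · rw [card_sdiff_of_subset hX]; omega

/-! ### Breaker's strategies -/

lemma exists_reply (R X : Finset TriCell) (b : ℕ) :
    ∃ g : Finset TriCell, g.card = b ∧ Disjoint g X ∧ (R.card ≤ b → R ⊆ g ∪ X) := by
  by_cases h : R.card ≤ b
  · obtain ⟨S, h1, h2, h3⟩ := exists_ext (R \ X) X b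
      ((card_le_card sdiff_subset).trans h) sdiff_disjoint
    refine ⟨S, h2, h3, fun _ q hq => ?_⟩
    by_cases hX : q ∈ X
    · exact mem_union_right _ hX
    · exact mem_union_left _ (h1 (mem_sdiff.2 ⟨hq, hX⟩))
  · obtain ⟨S, h1, h2, h3⟩ := exists_ext ∅ X b (by simp) (by simp)
    exact ⟨S, h2, h3, fun h' => absurd h' h⟩

noncomputable def reply (b : ℕ) (R X : Finset TriCell) : Finset TriCell :=
  (exists_reply R X b).choose

noncomputable def brState (σ : List (Finset TriCell) → Finset TriCell) (b : ℕ)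
    (R : Finset TriCell → Finset TriCell) :
    ℕ → List (Finset TriCell) × Finset TriCell × Finset TriCell
  | 0 => ([], ∅, ∅)
  | n + 1 =>
    let s := brState σ b R n
    let m := σ s.1
    let g := reply b (R m) (s.2.1 ∪ m ∪ s.2.2)
    (s.1 ++ [g], s.2.1 ∪ m, s.2.2 ∪ g)

noncomputable def brPlay (σ : List (Finset TriCell) → Finset TriCell) (b : ℕ)
    (R : Finset TriCell → Finset TriCell) (n : ℕ) : Finset TriCell :=
  reply b (R (σ (brState σ b R n).1))
    ((brState σ b R n).2.1 ∪ σ (brState σ b R n).1 ∪ (brState σ b R n).2.2)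

lemma brState_eq (σ : List (Finset TriCell) → Finset TriCell) (b : ℕ)
    (R : Finset TriCell → Finset TriCell) (n : ℕ) :
    brState σ b R n = ((List.range n).map (brPlay σ b R), makerMarks σ (brPlay σ b R) n,
      breakerMarks (brPlay σ b R) n) := by
  induction n with
  | zero => rfl
  | succ n ih =>
    have : brState σ b R (n + 1) = ((brState σ b R n).1 ++ [brPlay σ b R n],
      (brState σ b R n).2.1 ∪ σ (brState σ b R n).1,
      (brState σ b R n).2.2 ∪ brPlay σ b R n) := rfl
    rw [this, ih]
    simp [List.range_succ, makerMarks, breakerMarks, makerMove]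

lemma mem_makerMarks {σ : List (Finset TriCell) → Finset TriCell} {β : ℕ → Finset TriCell}
    {n : ℕ} {p : TriCell} : p ∈ makerMarks σ β n ↔ ∃ i < n, p ∈ makerMove σ β i := by
  induction n with
  | zero => simp [makerMarks]
  | succ n ih =>
    simp only [makerMarks, mem_union, ih]
    constructor
    · rintro (⟨i, hi, h⟩ | h)
      · exact ⟨i, by omega, h⟩
      · exact ⟨n, by omega, h⟩
    · rintro ⟨i, hi, h⟩
      rcases Nat.lt_succ_iff_lt_or_eq.1 hi with h' | rfl
      · exact Or.inl ⟨i, h', h⟩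
      · exact Or.inr h

lemma mem_breakerMarks {β : ℕ → Finset TriCell}
    {n : ℕ} {p : TriCell} : p ∈ breakerMarks β n ↔ ∃ i < n, p ∈ β i := by
  induction n with
  | zero => simp [breakerMarks]
  | succ n ih =>
    simp only [breakerMarks, mem_union, ih]
    constructor
    · rintro (⟨i, hi, h⟩ | h)
      · exact ⟨i, by omega, h⟩
      · exact ⟨n, by omega, h⟩
    · rintro ⟨i, hi, h⟩
      rcases Nat.lt_succ_iff_lt_or_eq.1 hi with h' | rfl
      · exact Or.inl ⟨i, h', h⟩
      · exact Or.inr h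

lemma loser_of (a b : ℕ) (R : Finset TriCell → Finset TriCell)
    (hR : ∀ S, S.card = a → (R S).card ≤ b)
    (hcomb : ∀ m : ℕ → Finset TriCell, (∀ n, (m n).card = a) →
      (∀ p i j, p ∈ m i → p ∈ m j → i = j) →
      (∀ q n j, q ∈ R (m n) → q ∈ m j → j ≤ n) →
      ∀ p0 p1 p2 p3 t0 t1 t2 t3, StripForm p0 p1 p2 p3 →
        p0 ∈ m t0 → p1 ∈ m t1 → p2 ∈ m t2 → p3 ∈ m t3 → False) :
    ¬ IsWinner T41 a b := by
  rintro ⟨σ, hσ⟩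
  have key : ∀ n, brPlay σ b R n = reply b (R (makerMove σ (brPlay σ b R) n))
      (makerMarks σ (brPlay σ b R) (n + 1) ∪ breakerMarks (brPlay σ b R) n) := by
    intro n
    conv_lhs => unfold brPlay
    rw [brState_eq]
    rfl
  set β := brPlay σ b R with hβ
  have hspec := fun n => (exists_reply (R (makerMove σ β n))
      (makerMarks σ β (n + 1) ∪ breakerMarks β n) b).choose_spec
  have hspec' : ∀ n, (β n).card = b ∧
      Disjoint (β n) (makerMarks σ β (n + 1) ∪ breakerMarks β n) ∧
      ((R (makerMove σ β n)).card ≤ b → R (makerMove σ β n) ⊆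
        β n ∪ (makerMarks σ β (n + 1) ∪ breakerMarks β n)) := by
    intro n
    have := hspec n
    rw [← reply, ← key n] at this
    exact this
  have hleg : BreakerLegal b σ β := fun n => ⟨(hspec' n).1, (hspec' n).2.1⟩
  obtain ⟨hm, n, P, hP, hsub⟩ := hσ β hleg
  obtain ⟨p0, p1, p2, p3, hF, h0, h1, h2, h3⟩ := placement_strip hP
  have hdisj : ∀ p i j, i < j → p ∈ makerMove σ β i → p ∈ makerMove σ β j → False := by
    intro p i j hij hi hj
    exact disjoint_left.1 (hm j).2 hj (mem_union_left _ (mem_makerMarks.2 ⟨i, hij, hi⟩))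
  have get : ∀ p ∈ P, ∃ t, p ∈ makerMove σ β t := by
    intro p hp
    obtain ⟨i, _, h⟩ := mem_makerMarks.1 (mem_coe.1 (hsub hp))
    exact ⟨i, h⟩
  obtain ⟨t0, h0⟩ := get _ h0
  obtain ⟨t1, h1⟩ := get _ h1
  obtain ⟨t2, h2⟩ := get _ h2
  obtain ⟨t3, h3⟩ := get _ h3
  refine hcomb (makerMove σ β) (fun n => (hm n).1) ?_ ?_ p0 p1 p2 p3 t0 t1 t2 t3 hF h0 h1 h2 h3
  · intro p i j hi hj
    rcases lt_trichotomy i j with h | h | h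
    · exact (hdisj p i j h hi hj).elim
    · exact h
    · exact (hdisj p j i h hj hi).elim
  · intro q n j hq hj
    by_contra hlt
    have := (hspec' n).2.2 (hR _ (hm n).1) hq
    have hnot := disjoint_left.1 (hm j).2 hj
    apply hnot
    simp only [mem_union, mem_makerMarks, mem_breakerMarks] at this ⊢
    rcases this with h | ⟨i, hi, h⟩ | ⟨i, hi, h⟩
    · exact Or.inr ⟨n, by omega, h⟩
    · exact Or.inl ⟨i, by omega, h⟩
    · exact Or.inr ⟨i, by omega, h⟩

/-- Neighbours. -/
def nbrs (p : TriCell) : Finset TriCell :=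
  if p.2.2 = 0 then {(p.1, p.2.1, 1), (p.1 - 1, p.2.1, 1), (p.1, p.2.1 - 1, 1)}
  else {(p.1, p.2.1, 0), (p.1 + 1, p.2.1, 0), (p.1, p.2.1 + 1, 0)}

/-- Neighbours off the Kekule matching: the edges with difference sum not divisible by 3. -/
def offNbrs (p : TriCell) : Finset TriCell :=
  (nbrs p).filter (fun q => ¬ (3 : ℤ) ∣ (p.1 - p.2.1) + (q.1 - q.2.1))

/-- The partner in the Kekule matching. -/
def onNbrs (p : TriCell) : Finset TriCell :=
  (nbrs p).filter (fun q => (3 : ℤ) ∣ (p.1 - p.2.1) + (q.1 - q.2.1))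

lemma card_nbrs (p : TriCell) : (nbrs p).card ≤ 3 := by
  unfold nbrs
  split_ifs <;> exact card_le_three

lemma mem_nbrs_iff (p q : TriCell) : q ∈ nbrs p ↔
    (p.2.2 = 0 ∧ (q = (p.1, p.2.1, 1) ∨ q = (p.1 - 1, p.2.1, 1) ∨ q = (p.1, p.2.1 - 1, 1))) ∨
    (p.2.2 = 1 ∧ (q = (p.1, p.2.1, 0) ∨ q = (p.1 + 1, p.2.1, 0) ∨ q = (p.1, p.2.1 + 1, 0))) := by
  obtain ⟨x, y, u⟩ := p
  fin_cases u <;> simp [nbrs]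

lemma nbrs_symm {p q : TriCell} (h : q ∈ nbrs p) : p ∈ nbrs q := by
  obtain ⟨x, y, u⟩ := p
  rw [mem_nbrs_iff] at h
  rcases h with ⟨h0, h | h | h⟩ | ⟨h0, h | h | h⟩ <;> simp only at h0 <;> subst h0 h <;>
    simp [nbrs]

lemma onNbrs_symm {p q : TriCell} (h : q ∈ onNbrs p) : p ∈ onNbrs q := by
  unfold onNbrs at *
  rw [mem_filter] at *
  exact ⟨nbrs_symm h.1, by rw [add_comm]; exact h.2⟩

lemma offNbrs_symm {p q : TriCell} (h : q ∈ offNbrs p) : p ∈ offNbrs q := by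
  unfold offNbrs at *
  rw [mem_filter] at *
  exact ⟨nbrs_symm h.1, by rw [add_comm]; exact h.2⟩

lemma nbrs_ne {p q : TriCell} (h : q ∈ nbrs p) : p ≠ q := by
  rintro rfl
  obtain ⟨x, y, u⟩ := p
  fin_cases u <;> simp [nbrs] at h

lemma card_onNbrs (p : TriCell) : (onNbrs p).card ≤ 1 := by
  rw [card_le_one]
  intro q hq r hr
  unfold onNbrs at hq hr
  rw [mem_filter, mem_nbrs_iff] at hq hr
  obtain ⟨x, y, u⟩ := p
  obtain ⟨hq, hq'⟩ := hq
  obtain ⟨hr, hr'⟩ := hr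
  rcases hq with ⟨h0, h | h | h⟩ | ⟨h0, h | h | h⟩ <;>
  rcases hr with ⟨h1, h' | h' | h'⟩ | ⟨h1, h' | h' | h'⟩ <;> subst h h' <;>
  simp only [Prod.mk.injEq] at * <;> omega

lemma onNbrs_nonempty (p : TriCell) : 1 ≤ (onNbrs p).card := by
  rw [Nat.succ_le_iff, card_pos]
  obtain ⟨x, y, u⟩ := p
  have h3 : (x - y) % 3 = 0 ∨ (x - y) % 3 = 1 ∨ (x - y) % 3 = 2 := by omega
  fin_cases u
  · rcases h3 with h | h | h
    · exact ⟨(x, y, 1), by simp [onNbrs, nbrs]; omega⟩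
    · exact ⟨(x, y - 1, 1), by simp [onNbrs, nbrs]; omega⟩
    · exact ⟨(x - 1, y, 1), by simp [onNbrs, nbrs]; omega⟩
  · rcases h3 with h | h | h
    · exact ⟨(x, y, 0), by simp [onNbrs, nbrs]; omega⟩
    · exact ⟨(x + 1, y, 0), by simp [onNbrs, nbrs]; omega⟩
    · exact ⟨(x, y + 1, 0), by simp [onNbrs, nbrs]; omega⟩

lemma card_offNbrs (p : TriCell) : (offNbrs p).card ≤ 2 := by
  have h := card_filter_add_card_filter_not (s := nbrs p)
    (fun q : TriCell => (3 : ℤ) ∣ (p.1 - p.2.1) + (q.1 - q.2.1))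
  have h1 := onNbrs_nonempty p
  have h2 := card_nbrs p
  unfold onNbrs at h1
  unfold offNbrs
  omega

lemma strip_nbrs {p0 p1 p2 p3 : TriCell} (h : StripForm p0 p1 p2 p3) :
    p0 ∈ nbrs p1 ∧ p2 ∈ nbrs p1 ∧ p2 ∈ nbrs p3 := by
  obtain ⟨x, y, a, c, b, d, ha, hb, hab, rfl, rfl, rfl, rfl⟩ := h
  simp only [mem_nbrs_iff, Prod.mk.injEq]
  simp
  omega

lemma strip_ne {p0 p1 p2 p3 : TriCell} (h : StripForm p0 p1 p2 p3) :
    p0 ≠ p1 ∧ p0 ≠ p2 ∧ p0 ≠ p3 ∧ p1 ≠ p2 ∧ p1 ≠ p3 ∧ p2 ≠ p3 := by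
  obtain ⟨x, y, a, c, b, d, ha, hb, hab, rfl, rfl, rfl, rfl⟩ := h
  simp only [ne_eq, Prod.mk.injEq]
  simp
  omega

lemma strip_kek {p0 p1 p2 p3 : TriCell} (h : StripForm p0 p1 p2 p3) :
    (p0 ∈ onNbrs p1 ∧ p2 ∈ offNbrs p1 ∧ p2 ∈ offNbrs p3) ∨
    (p0 ∈ offNbrs p1 ∧ p2 ∈ onNbrs p1 ∧ p2 ∈ offNbrs p3) ∨
    (p0 ∈ offNbrs p1 ∧ p2 ∈ offNbrs p1 ∧ p2 ∈ onNbrs p3) := by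
  have hn := strip_nbrs h
  obtain ⟨x, y, a, c, b, d, ha, hb, hab, rfl, rfl, rfl, rfl⟩ := h
  simp only [onNbrs, offNbrs, mem_filter, hn.1, hn.2.1, hn.2.2, true_and]
  clear hn
  obtain ⟨k, hk⟩ : ∃ k, x = y + 3 * k ∨ x = y + 3 * k + 1 ∨ x = y + 3 * k + 2 :=
    ⟨(x - y) / 3, by omega⟩
  rcases ha with ⟨rfl, rfl⟩ | ⟨rfl, rfl⟩ | ⟨rfl, rfl⟩ <;>
  rcases hb with ⟨rfl, rfl⟩ | ⟨rfl, rfl⟩ | ⟨rfl, rfl⟩ <;>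
  rcases hk with rfl | rfl | rfl <;> omega

lemma loser_39 : ¬ IsWinner T41 3 9 := by
  refine loser_of 3 9 (fun S => S.biUnion nbrs) ?_ ?_
  · intro S hS
    have := card_biUnion_le_card_mul S nbrs 3 (fun p _ => card_nbrs p)
    omega
  · intro m hc hu hR p0 p1 p2 p3 t0 t1 t2 t3 hF h0 h1 h2 h3
    have adj : ∀ p q i j, q ∈ nbrs p → p ∈ m i → q ∈ m j → i = j := by
      intro p q i j hpq hi hj
      exact le_antisymm (hR p j i (mem_biUnion.2 ⟨q, hj, nbrs_symm hpq⟩) hi)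
        (hR q i j (mem_biUnion.2 ⟨p, hi, hpq⟩) hj)
    obtain ⟨n1, n2, n3⟩ := strip_nbrs hF
    obtain rfl := adj _ _ _ _ n1 h1 h0
    obtain rfl := adj _ _ _ _ n2 h1 h2
    obtain rfl := adj _ _ _ _ n3 h3 h2
    obtain ⟨e1, e2, e3, e4, e5, e6⟩ := strip_ne hF
    have hs : ({p0, p1, p2, p3} : Finset TriCell) ⊆ m t3 := by
      intro p hp
      simp only [mem_insert, mem_singleton] at hp
      rcases hp with rfl | rfl | rfl | rfl <;> assumption
    have h4 : ({p0, p1, p2, p3} : Finset TriCell).card = 4 := by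
      simp [e1, e2, e3, e4, e5, e6]
    have := card_le_card hs
    rw [hc] at this
    omega

lemma loser_11 : ¬ IsWinner T41 1 1 := by
  refine loser_of 1 1 (fun S => S.biUnion onNbrs) ?_ ?_
  · intro S hS
    have := card_biUnion_le_card_mul S onNbrs 1 (fun p _ => card_onNbrs p)
    omega
  · intro m hc hu hR p0 p1 p2 p3 t0 t1 t2 t3 hF h0 h1 h2 h3
    have adj : ∀ p q i j, q ∈ onNbrs p → p ∈ m i → q ∈ m j → False := by
      intro p q i j hpq hi hj
      have : i = j := le_antisymm (hR p j i (mem_biUnion.2 ⟨q, hj, onNbrs_symm hpq⟩) hi)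
        (hR q i j (mem_biUnion.2 ⟨p, hi, hpq⟩) hj)
      subst this
      exact nbrs_ne (mem_filter.1 hpq).1 (card_le_one.1 (hc i).le p hi q hj)
    rcases strip_kek hF with h | h | h
    · exact adj _ _ _ _ h.1 h1 h0
    · exact adj _ _ _ _ h.2.1 h1 h2
    · exact adj _ _ _ _ h.2.2 h3 h2

open Classical in
noncomputable def rep24 (S : Finset TriCell) : Finset TriCell :=
  if ∃ u ∈ S, ∃ v ∈ S, v ∈ offNbrs u then S.biUnion nbrs \ S else S.biUnion offNbrs

lemma loser_24 : ¬ IsWinner T41 2 4 := by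
  refine loser_of 2 4 rep24 ?_ ?_
  · intro S hS
    unfold rep24
    split_ifs with h
    · obtain ⟨u, hu, v, hv, huv⟩ := h
      have huv := (mem_filter.1 huv).1
      have hvu := nbrs_symm huv
      have hne := nbrs_ne huv
      have hS' : S = {u, v} := by
        symm
        apply eq_of_subset_of_card_le
        · intro p hp
          simp only [mem_insert, mem_singleton] at hp
          rcases hp with rfl | rfl <;> assumption
        · rw [hS, card_pair hne]
      have hsub : S.biUnion nbrs \ S ⊆ (nbrs u).erase v ∪ (nbrs v).erase u := by
        intro p hp
        rw [hS'] at hp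
        simp only [mem_sdiff, mem_biUnion, mem_insert, mem_singleton, exists_eq_or_imp,
          exists_eq_left, mem_union, mem_erase] at hp ⊢
        tauto
      have h1 := card_le_card hsub
      have h2 := card_union_le ((nbrs u).erase v) ((nbrs v).erase u)
      rw [card_erase_of_mem huv, card_erase_of_mem hvu] at h2
      have := card_nbrs u
      have := card_nbrs v
      omega
    · have := card_biUnion_le_card_mul S offNbrs 2 (fun p _ => card_offNbrs p)
      omega
  · intro m hc hu hR p0 p1 p2 p3 t0 t1 t2 t3 hF h0 h1 h2 h3
    -- off-matching edges are completed within one turn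
    have half : ∀ p q i j, q ∈ offNbrs p → p ∈ m i → q ∈ m j → j ≤ i := by
      intro p q i j hpq hi hj
      by_cases hq : q ∈ m i
      · exact (hu q j i hj hq).le
      · apply hR q i j _ hj
        unfold rep24
        split_ifs with h
        · exact mem_sdiff.2 ⟨mem_biUnion.2 ⟨p, hi, (mem_filter.1 hpq).1⟩, hq⟩
        · exact mem_biUnion.2 ⟨p, hi, hpq⟩
    have adj : ∀ p q i j, q ∈ offNbrs p → p ∈ m i → q ∈ m j → i = j := by
      intro p q i j hpq hi hj
      exact le_antisymm (half q p j i (offNbrs_symm hpq) hj hi) (half p q i j hpq hi hj)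
    have three : ∀ p q r i, p ≠ q → p ≠ r → q ≠ r → p ∈ m i → q ∈ m i → r ∈ m i → False := by
      intro p q r i a1 a2 a3 b1 b2 b3
      have hs : ({p, q, r} : Finset TriCell) ⊆ m i := by
        intro z hz
        simp only [mem_insert, mem_singleton] at hz
        rcases hz with rfl | rfl | rfl <;> assumption
      have h4 : ({p, q, r} : Finset TriCell).card = 3 := by
        simp [a1, a2, a3]
      have := card_le_card hs
      rw [hc] at this
      omega
    have full : ∀ p q r i j, q ∈ offNbrs p → p ∈ m i → q ∈ m i → r ∈ nbrs p → r ∈ m j →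
        j ≤ i := by
      intro p q r i j hpq hp hq hr hj
      by_cases hri : r ∈ m i
      · exact (hu r j i hj hri).le
      · apply hR r i j _ hj
        unfold rep24
        rw [if_pos ⟨p, hp, q, hq, hpq⟩]
        exact mem_sdiff.2 ⟨mem_biUnion.2 ⟨p, hp, hr⟩, hri⟩
    obtain ⟨e1, e2, e3, e4, e5, e6⟩ := strip_ne hF
    obtain ⟨n1, n2, n3⟩ := strip_nbrs hF
    rcases strip_kek hF with ⟨_, a, b⟩ | ⟨a, _, b⟩ | ⟨a, b, _⟩
    · obtain rfl := adj _ _ _ _ a h1 h2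
      obtain rfl := adj _ _ _ _ b h3 h2
      exact three p1 p2 p3 _ e4 e5 e6 h1 h2 h3
    · obtain rfl := adj _ _ _ _ a h1 h0
      obtain rfl := adj _ _ _ _ b h3 h2
      have c1 := full p1 p0 p2 _ _ a h1 h0 n2 h2
      have c2 := full p2 p3 p1 _ _ (offNbrs_symm b) h2 h3 (nbrs_symm n2) h1
      obtain rfl := le_antisymm c1 c2
      exact three p0 p1 p2 _ e1 e2 e4 h0 h1 h2
    · obtain rfl := adj _ _ _ _ a h1 h0
      obtain rfl := adj _ _ _ _ b h1 h2
      exact three p0 p1 p2 _ e1 e2 e4 h0 h1 h2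

/-! ### Maker's strategies -/

def WinMove (a : ℕ) (M B S : Finset TriCell) : Prop :=
  S.card = a ∧ Disjoint S (M ∪ B) ∧ ∃ P : Set TriCell, IsTriPlacement T41 P ∧ P ⊆ ↑(M ∪ S)

open Classical in
noncomputable def mkMove (a : ℕ) (S0 M B : Finset TriCell) : Finset TriCell :=
  if M = ∅ ∧ B = ∅ then S0
  else if h : ∃ S, WinMove a M B S then h.choose
  else (exists_ext ∅ (M ∪ B) a (by simp) (by simp)).choose

lemma mkMove_legal (a : ℕ) (S0 M B : Finset TriCell) (h0 : S0.card = a) :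
    (mkMove a S0 M B).card = a ∧ Disjoint (mkMove a S0 M B) (M ∪ B) := by
  unfold mkMove
  split_ifs with h1 h2
  · rw [h1.1, h1.2]
    exact ⟨h0, by simp⟩
  · exact ⟨h2.choose_spec.1, h2.choose_spec.2.1⟩
  · exact (exists_ext ∅ (M ∪ B) a (by simp) (by simp)).choose_spec.2

noncomputable def mkState (a : ℕ) (S0 : Finset TriCell) (h : List (Finset TriCell)) :
    Finset TriCell × Finset TriCell :=
  h.foldl (fun s b => (s.1 ∪ mkMove a S0 s.1 s.2, s.2 ∪ b)) (∅, ∅)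

noncomputable def mkStrat (a : ℕ) (S0 : Finset TriCell) (h : List (Finset TriCell)) :
    Finset TriCell :=
  mkMove a S0 (mkState a S0 h).1 (mkState a S0 h).2

lemma mkState_eq (a : ℕ) (S0 : Finset TriCell) (β : ℕ → Finset TriCell) (n : ℕ) :
    mkState a S0 ((List.range n).map β) = (makerMarks (mkStrat a S0) β n, breakerMarks β n) := by
  induction n with
  | zero => rfl
  | succ n ih =>
    have : mkState a S0 ((List.range (n + 1)).map β) =
        ((mkState a S0 ((List.range n).map β)).1 ∪ mkStrat a S0 ((List.range n).map β),
          (mkState a S0 ((List.range n).map β)).2 ∪ β n) := by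
      rw [List.range_succ, List.map_append, mkState, List.foldl_append]
      rfl
    rw [this, ih]
    rfl

lemma winner_of (a b : ℕ) (ha : 1 ≤ a) (S0 : Finset TriCell) (h0 : S0.card = a)
    (h : ∀ B : Finset TriCell, B.card = b → Disjoint B S0 →
      ∃ P : Finset TriCell, IsTriPlacement T41 (↑P : Set TriCell) ∧ Disjoint P B ∧
        (P \ S0).card ≤ a) : IsWinner T41 a b := by
  refine ⟨mkStrat a S0, fun β hβ => ⟨?_, 2, ?_⟩⟩
  · intro n
    have := mkMove_legal a S0 (makerMarks (mkStrat a S0) β n) (breakerMarks β n) h0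
    unfold makerMove mkStrat
    rw [mkState_eq]
    exact this
  · have hm1 : makerMarks (mkStrat a S0) β 1 = S0 := by
      simp [makerMarks, makerMove, mkStrat, mkState, mkMove]
    have hb1 : breakerMarks β 1 = β 0 := by simp [breakerMarks]
    have hb := hβ 0
    rw [zero_add, hm1] at hb
    obtain ⟨P, hP, hPB, hPc⟩ := h (β 0) hb.1 (disjoint_of_subset_right subset_union_left hb.2)
    have hex : ∃ S, WinMove a S0 (β 0) S := by
      obtain ⟨S, s1, s2, s3⟩ := exists_ext (P \ S0) (S0 ∪ β 0) a hPc (by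
        rw [disjoint_union_right]
        exact ⟨sdiff_disjoint, disjoint_of_subset_left sdiff_subset hPB⟩)
      refine ⟨S, s2, s3, ↑P, hP, ?_⟩
      rw [coe_subset]
      intro p hp
      by_cases hq : p ∈ S0
      · exact mem_union_left _ hq
      · exact mem_union_right _ (s1 (mem_sdiff.2 ⟨hp, hq⟩))
    have hne : ¬ (S0 = ∅ ∧ β 0 = ∅) := by
      rintro ⟨h, _⟩
      rw [h, card_empty] at h0
      omega
    have hm2 : makerMarks (mkStrat a S0) β 2 = S0 ∪ hex.choose := by
      have : makerMarks (mkStrat a S0) β 2 =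
        makerMarks (mkStrat a S0) β 1 ∪ mkStrat a S0 ((List.range 1).map β) := rfl
      rw [this, mkStrat, mkState_eq, hm1, hb1]
      simp only [mkMove]
      rw [if_neg hne, dif_pos hex]
    rw [hm2]
    exact hex.choose_spec.2.2

lemma pigeon {ι : Type} [Fintype ι] (Q : ι → Finset TriCell) (B : Finset TriCell)
    (hQ : ∀ i j p, p ∈ Q i → p ∈ Q j → i = j) (hB : B.card < Fintype.card ι) :
    ∃ i, Disjoint (Q i) B := by
  by_contra! hcon
  have : ∀ i, ∃ p, p ∈ Q i ∧ p ∈ B := fun i => by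
    have := hcon i
    rw [not_disjoint_iff] at this
    exact this
  choose f hf using this
  have := card_le_card_of_injOn (s := univ) (t := B) f (fun i _ => (hf i).2)
    (fun i _ j _ hij => hQ i j (f i) (hf i).1 (hij ▸ (hf j).1))
  rw [card_univ] at this
  omega

lemma sym_trans (s t : ℤ) :
    (fun p : TriCell => (p.1 + s, p.2.1 + t, p.2.2) : Function.End TriCell) ∈ triSymmetries :=
  Submonoid.subset_closure (Or.inl ⟨s, t, rfl⟩)

lemma sym_rot : triRot ∈ triSymmetries := Submonoid.subset_closure (Or.inr (Or.inl rfl))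

lemma sym_refl : triRefl ∈ triSymmetries := Submonoid.subset_closure (Or.inr (Or.inr rfl))

lemma placement_of (f : TriCell → TriCell) (hf : (f : Function.End TriCell) ∈ triSymmetries)
    (P : Finset TriCell)
    (h : P = {f (0, 0, 0), f (0, 0, 1), f (1, 0, 0), f (1, 0, 1)}) :
    IsTriPlacement T41 (↑P : Set TriCell) := by
  refine ⟨f, hf, ?_⟩
  subst h
  simp [T41, Set.image_insert_eq]

lemma pl_right (X : ℤ) : IsTriPlacement T41
    (↑({(X, 0, 0), (X, 0, 1), (X + 1, 0, 0), (X + 1, 0, 1)} : Finset TriCell) : Set TriCell) :=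
  placement_of _ (sym_trans X 0) _ (by simp [add_comm])

lemma pl_vert (X Y : ℤ) : IsTriPlacement T41
    (↑({(X, Y, 0), (X, Y, 1), (X, Y + 1, 0), (X, Y + 1, 1)} : Finset TriCell) :
      Set TriCell) :=
  placement_of (fun p => ((triRefl p).1 + X, (triRefl p).2.1 + Y, (triRefl p).2.2))
    (mul_mem (sym_trans X Y) sym_refl) _ (by
    simp [triRefl, add_comm])

lemma pl_down (X : ℤ) : IsTriPlacement T41
    (↑({(X, -2, 1), (X, -1, 0), (X, -1, 1), (X, 0, 0)} : Finset TriCell) : Set TriCell) :=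
  placement_of (fun p => ((triRot p).1 + (X + 1), (triRot p).2.1 + (-2), (triRot p).2.2))
    (mul_mem (sym_trans (X + 1) (-2)) sym_rot) _ (by
    simp [triRot])

lemma pl_left (X : ℤ) : IsTriPlacement T41
    (↑({(X - 2, 0, 1), (X - 1, 0, 0), (X - 1, 0, 1), (X, 0, 0)} : Finset TriCell) :
      Set TriCell) :=
  placement_of (fun p => ((triRefl (triRot p)).1 + (X - 2), (triRefl (triRot p)).2.1 + 1,
      (triRefl (triRot p)).2.2))
    (mul_mem (sym_trans (X - 2) 1) (mul_mem sym_refl sym_rot)) _ (by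
    simp [triRot, triRefl]; ring_nf)

lemma winner_family {ι : Type} [Fintype ι] (a b : ℕ) (ha : 1 ≤ a) (S0 : Finset TriCell)
    (h0 : S0.card = a) (P : ι → Finset TriCell)
    (hP : ∀ i, IsTriPlacement T41 (↑(P i) : Set TriCell))
    (hc : ∀ i, (P i \ S0).card ≤ a) (hb : b < Fintype.card ι)
    (hd : ∀ i j, i ≠ j → Disjoint (P i \ S0) (P j \ S0)) : IsWinner T41 a b := by
  refine winner_of a b ha S0 h0 fun B hB hdis => ?_
  obtain ⟨i, hi⟩ := pigeon (fun i => P i \ S0) B (by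
    intro i j p hpi hpj
    by_contra hij
    exact disjoint_left.1 (hd i j hij) hpi hpj) (by omega)
  refine ⟨P i, hP i, ?_, hc i⟩
  rw [disjoint_left]
  intro p hp hpB
  by_cases hS : p ∈ S0
  · exact disjoint_left.1 hdis hpB hS
  · exact disjoint_left.1 hi (mem_sdiff.2 ⟨hp, hS⟩) hpB

def fam23 : Fin 4 → Finset TriCell :=
  ![{(0, 0, 0), (0, 0, 1), (0 + 1, 0, 0), (0 + 1, 0, 1)},
    {(-1, 0, 0), (-1, 0, 1), (-1 + 1, 0, 0), (-1 + 1, 0, 1)},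
    {(0, 0, 0), (0, 0, 1), (0, 0 + 1, 0), (0, 0 + 1, 1)},
    {(0, -1, 0), (0, -1, 1), (0, -1 + 1, 0), (0, -1 + 1, 1)}]

lemma winner_23 : IsWinner T41 2 3 := by
  refine winner_family 2 3 (by norm_num) {(0, 0, 0), (0, 0, 1)} (by decide) fam23 ?_
    (by decide) (by decide) (by decide)
  intro i
  fin_cases i
  · exact pl_right 0
  · exact pl_right (-1)
  · exact pl_vert 0 0
  · exact pl_vert 0 (-1)

def fam38 (k : Fin 3 × Fin 3) : Finset TriCell :=
  ![{(10 * (k.1.val : ℤ), 0, 0), (10 * (k.1.val : ℤ), 0, 1), (10 * (k.1.val : ℤ) + 1, 0, 0),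
      (10 * (k.1.val : ℤ) + 1, 0, 1)},
    {(10 * (k.1.val : ℤ), -2, 1), (10 * (k.1.val : ℤ), -1, 0), (10 * (k.1.val : ℤ), -1, 1),
      (10 * (k.1.val : ℤ), 0, 0)},
    {(10 * (k.1.val : ℤ) - 2, 0, 1), (10 * (k.1.val : ℤ) - 1, 0, 0),
      (10 * (k.1.val : ℤ) - 1, 0, 1), (10 * (k.1.val : ℤ), 0, 0)}] k.2

lemma winner_38 : IsWinner T41 3 8 := by
  refine winner_family 3 8 (by norm_num) {(0, 0, 0), (10, 0, 0), (20, 0, 0)} (by decide) fam38 ?_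
    (by decide) (by decide) (by decide)
  rintro ⟨k, i⟩
  fin_cases i
  · exact pl_right _
  · exact pl_down _
  · exact pl_left _

lemma winner_big (n b : ℕ) (hn : 4 ≤ n) : IsWinner T41 n b := by
  obtain ⟨S, h1, h2, _⟩ := exists_ext T41 ∅ n (by rw [show T41.card = 4 by decide]; exact hn)
    (by simp)
  refine winner_of n b (by omega) S h2 fun B _ hd => ⟨T41, pl_right 0, ?_, ?_⟩
  · exact disjoint_of_subset_left h1 hd.symm
  · rw [sdiff_eq_empty_iff_subset.2 h1]
    simp

def seqCell (k : ℕ) : TriCell := ((k / 2 : ℕ), 0, if k % 2 = 0 then 0 else 1)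

lemma seqCell_inj {i j : ℕ} (h : seqCell i = seqCell j) : i = j := by
  simp only [seqCell, Prod.mk.injEq] at h
  obtain ⟨h1, -, h2⟩ := h
  split_ifs at h2 <;> omega

lemma winner_10 : IsWinner T41 1 0 := by
  refine ⟨fun h => {seqCell h.length}, fun β hβ => ⟨?_, 4, _, pl_right 0, ?_⟩⟩
  · intro n
    refine ⟨by simp [makerMove], ?_⟩
    rw [disjoint_left]
    intro p hp hq
    rw [mem_union, mem_makerMarks, mem_breakerMarks] at hq
    rcases hq with ⟨i, hi, h⟩ | ⟨i, hi, h⟩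
    · simp only [makerMove, List.length_map, List.length_range, mem_singleton] at hp h
      have := seqCell_inj (hp.symm.trans h)
      omega
    · rw [card_eq_zero.1 (hβ i).1] at h
      simp at h
  · rw [coe_subset]
    intro p hp
    rw [mem_makerMarks]
    simp only [mem_insert, mem_singleton] at hp
    rcases hp with rfl | rfl | rfl | rfl
    · exact ⟨0, by omega, by simp [makerMove, seqCell]⟩
    · exact ⟨1, by omega, by simp [makerMove, seqCell]⟩
    · exact ⟨2, by omega, by simp [makerMove, seqCell]⟩
    · exact ⟨3, by omega, by simp [makerMove, seqCell]⟩

end T41Aux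

/-- `T₄,₁` has threshold sequence `(0, 3, 8, ∞)`: it is a `(1,0)`-winner, a `(1,1)`-loser,
a `(2,3)`-winner, a `(2,4)`-loser, a `(3,8)`-winner, a `(3,9)`-loser, and an
`(n,b)`-winner for every `n ≥ 4` and every `b`. -/
theorem T41_threshold :
    IsWinner T41 1 0 ∧ ¬ IsWinner T41 1 1 ∧
    IsWinner T41 2 3 ∧ ¬ IsWinner T41 2 4 ∧
    IsWinner T41 3 8 ∧ ¬ IsWinner T41 3 9 ∧
    ∀ n b : ℕ, 4 ≤ n → IsWinner T41 n b := by
  exact ⟨winner_10, loser_11, winner_23, loser_24, winner_38, loser_39, winner_big⟩
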